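/- arXiv:math/0412002 — 3 statements merged into one kernel-verified Lean document; each statement's English description precedes it below -/
import Mathlib

section
/- Let I ⊆ ℂ[x₀,x₁,x₂] be a Borel-fixed monomial ideal of colength 10 that contains no monomial of degree 1, contains exactly one monomial of degree 2, and is generated by the monomials of degree at most 4 that it contains. Then I = (x₀², x₀x₁², x₀x₁x₂, x₀x₂², x₁³, x₁²x₂, x₁x₂², x₂⁴) (that is, I = Borel(x₁x₂²) + (x₀², x₂⁴)). -/
open MvPolynomial

/-- The exponent vector `(a, b, c)`. -/
noncomputable def expVec (p : ℕ × ℕ × ℕ) : Fin 3 →₀ ℕ :=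
  Finsupp.equivFunOnFinite.symm ![p.1, p.2.1, p.2.2]

@[simp] lemma expVec_zero (p : ℕ × ℕ × ℕ) : expVec p 0 = p.1 := rfl
@[simp] lemma expVec_one (p : ℕ × ℕ × ℕ) : expVec p 1 = p.2.1 := rfl
@[simp] lemma expVec_two (p : ℕ × ℕ × ℕ) : expVec p 2 = p.2.2 := rfl

lemma expVec_surj (e : Fin 3 →₀ ℕ) : expVec (e 0, e 1, e 2) = e := by
  ext i; fin_cases i <;> rfl

lemma expVec_bijective : Function.Bijective expVec := by
  refine ⟨fun p q h => ?_, fun e => ⟨_, expVec_surj e⟩⟩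
  have h0 := DFunLike.congr_fun h 0
  have h1 := DFunLike.congr_fun h 1
  have h2 := DFunLike.congr_fun h 2
  simp only [expVec_zero, expVec_one, expVec_two] at h0 h1 h2
  exact Prod.ext h0 (Prod.ext h1 h2)

lemma expVec_degree (p : ℕ × ℕ × ℕ) :
    ((expVec p).sum fun _ n => n) = p.1 + p.2.1 + p.2.2 := by
  rw [Finsupp.sum_fintype _ _ (fun _ => rfl), Fin.sum_univ_three]; rfl

lemma monomial_expVec (a b c : ℕ) :
    monomial (expVec (a, b, c)) (1 : ℂ) = X 0 ^ a * X 1 ^ b * X 2 ^ c := by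
  rw [monomial_eq, Finsupp.prod_fintype _ _ (fun _ => pow_zero _), Fin.prod_univ_three]
  simp

/-- Exponents of the monomials outside `(x₀²) + (x₀, x₁, x₂)³`. -/
def smallExponents : Finset (ℕ × ℕ × ℕ) :=
  {(0, 0, 0), (1, 0, 0), (0, 1, 0), (0, 0, 1), (1, 1, 0), (1, 0, 1), (0, 2, 0), (0, 1, 1),
    (0, 0, 2)}

lemma mem_smallExponents {a b c : ℕ} (hd : a + b + c ≤ 2) (ha : a ≠ 2) :
    (a, b, c) ∈ smallExponents := by
  have : a ≤ 2 := by omega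
  have : b ≤ 2 := by omega
  have : c ≤ 2 := by omega
  interval_cases a <;> interval_cases b <;> interval_cases c <;> first | omega | decide

/-- A Borel-fixed set of exponents with ten-element complement whose only member of degree at
most two is `(2, 0, 0)` has complement `smallExponents ∪ {(0, 0, 3)}`. -/
lemma not_mem_iff_of_borel (P : ℕ × ℕ × ℕ → Prop)
    (hup : ∀ p q, p ≤ q → P p → P q)
    (h10 : ∀ a b c, P (a, b + 1, c) → P (a + 1, b, c))
    (h21 : ∀ a b c, P (a, b, c + 1) → P (a, b + 1, c))
    (hcard : {p | ¬ P p}.ncard = 10)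
    (hsq : P (2, 0, 0))
    (hlow : ∀ p ∈ smallExponents, ¬ P p) (p : ℕ × ℕ × ℕ) :
    ¬ P p ↔ p ∈ insert (0, 0, 3) smallExponents := by
  have hall : ∀ n, P (0, 0, n) → ∀ a b c, a + b + c = n → P (a, b, c) := by
    intro n hn
    have h1 : ∀ b c, b + c = n → P (0, b, c) := by
      intro b
      induction b with
      | zero => rintro c rfl; simpa using hn
      | succ b ih => exact fun c hc => h21 _ _ _ (ih (c + 1) (by omega))
    intro a
    induction a with
    | zero => exact fun b c hc => h1 b c (by omega)
    | succ a ih => exact fun b c hc => h10 _ _ _ (ih (b + 1) c (by omega))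
  have h3 : ¬ P (0, 0, 3) := by
    intro h3
    have hsub : {p | ¬ P p} ⊆ (smallExponents : Set (ℕ × ℕ × ℕ)) := by
      rintro ⟨a, b, c⟩ hp
      have hd : a + b + c ≤ 2 := by
        by_contra hd
        refine hp (hall (a + b + c) (hup _ _ ?_ h3) a b c rfl)
        exact ⟨le_rfl, le_rfl, by simp only; omega⟩
      refine mem_smallExponents hd fun ha => hp (hup _ _ ?_ hsq)
      exact ⟨ha.ge, Nat.zero_le _, Nat.zero_le _⟩
    have := Set.ncard_le_ncard hsub (Finset.finite_toSet _)
    rw [Set.ncard_coe_finset, hcard] at this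
    revert this; decide
  have hsub : ((insert (0, 0, 3) smallExponents : Finset (ℕ × ℕ × ℕ)) : Set (ℕ × ℕ × ℕ)) ⊆
      {p | ¬ P p} := by
    intro q hq
    rcases Finset.mem_insert.1 (Finset.mem_coe.1 hq) with rfl | hq
    exacts [h3, hlow q hq]
  have heq := Set.eq_of_subset_of_ncard_le hsub
    (by rw [hcard, Set.ncard_coe_finset]; decide) (Set.finite_of_ncard_ne_zero (by omega))
  rw [← Finset.mem_coe, heq, Set.mem_ofPred_eq]

lemma monomial_mem_of_le {I : Ideal (MvPolynomial (Fin 3) ℂ)} {d e : Fin 3 →₀ ℕ} (h : d ≤ e)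
    (hd : monomial d (1 : ℂ) ∈ I) : monomial e (1 : ℂ) ∈ I :=
  I.mem_of_dvd (monomial_dvd_monomial.2 ⟨Or.inr h, dvd_rfl⟩) hd

lemma expVec_mono {p q : ℕ × ℕ × ℕ} (h : p ≤ q) : expVec p ≤ expVec q := by
  intro i; fin_cases i
  exacts [h.1, h.2.1, h.2.2]

/-- Exponents of the generators of `(x₀², x₀x₁², x₀x₁x₂, x₀x₂², x₁³, x₁²x₂, x₁x₂², x₂⁴)`. -/
def generatorExponents : Finset (ℕ × ℕ × ℕ) :=
  {(2, 0, 0), (1, 2, 0), (1, 1, 1), (1, 0, 2), (0, 3, 0), (0, 2, 1), (0, 1, 2), (0, 0, 4)}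

lemma exists_generatorExponents_le {p : ℕ × ℕ × ℕ}
    (hp : p ∉ insert (0, 0, 3) smallExponents) : ∃ q ∈ generatorExponents, q ≤ p := by
  obtain ⟨a, b, c⟩ := p
  by_contra! h
  have ha : a < 2 := by
    by_contra! ha
    exact h (2, 0, 0) (by decide) ⟨ha, Nat.zero_le _, Nat.zero_le _⟩
  have hb : b < 3 := by
    by_contra! hb
    exact h (0, 3, 0) (by decide) ⟨Nat.zero_le _, hb, Nat.zero_le _⟩
  have hc : c < 4 := by
    by_contra! hc
    exact h (0, 0, 4) (by decide) ⟨Nat.zero_le _, Nat.zero_le _, hc⟩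
  interval_cases a <;> interval_cases b <;> interval_cases c <;> revert hp h <;> decide

lemma span_generators_eq :
    (Ideal.span {X 0 ^ 2, X 0 * X 1 ^ 2, X 0 * X 1 * X 2, X 0 * X 2 ^ 2,
          X 1 ^ 3, X 1 ^ 2 * X 2, X 1 * X 2 ^ 2, X 2 ^ 4} : Ideal (MvPolynomial (Fin 3) ℂ)) =
      Ideal.span ((fun p => monomial (expVec p) (1 : ℂ)) '' generatorExponents) := by
  simp [generatorExponents, Set.image_insert_eq, monomial_expVec]

/-- Let `I ⊆ ℂ[x₀,x₁,x₂]` be a Borel-fixed monomial ideal of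
colength 10 containing no monomial of degree 1, exactly one monomial of degree 2,
and generated by the monomials of degree at most 4 that it contains.  Then
`I = (x₀², x₀x₁², x₀x₁x₂, x₀x₂², x₁³, x₁²x₂, x₁x₂², x₂⁴)`. -/
theorem stmt_4 (I : Ideal (MvPolynomial (Fin 3) ℂ))
    (G : Set (Fin 3 →₀ ℕ))
    (hI : I = Ideal.span ((fun e => monomial e (1 : ℂ)) '' G))
    (hBorel : ∀ e : Fin 3 →₀ ℕ, monomial e (1 : ℂ) ∈ I →
      ∀ i j : Fin 3, i < j → e j ≠ 0 →
        monomial (e - Finsupp.single j 1 + Finsupp.single i 1) (1 : ℂ) ∈ I)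
    (hcolen : {e : Fin 3 →₀ ℕ | monomial e (1 : ℂ) ∉ I}.ncard = 10)
    (hdeg1 : ∀ e : Fin 3 →₀ ℕ, (e.sum fun _ n => n) = 1 → monomial e (1 : ℂ) ∉ I)
    (hdeg2 : {e : Fin 3 →₀ ℕ | (e.sum fun _ n => n) = 2 ∧ monomial e (1 : ℂ) ∈ I}.ncard = 1)
    (hgen4 : I = Ideal.span
      ((fun e => monomial e (1 : ℂ)) ''
        {e : Fin 3 →₀ ℕ | (e.sum fun _ n => n) ≤ 4 ∧ monomial e (1 : ℂ) ∈ I})) :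
    I = Ideal.span {X 0 ^ 2, X 0 * X 1 ^ 2, X 0 * X 1 * X 2, X 0 * X 2 ^ 2,
          X 1 ^ 3, X 1 ^ 2 * X 2, X 1 * X 2 ^ 2, X 2 ^ 4} := by
  have hup : ∀ p q, p ≤ q → monomial (expVec p) (1 : ℂ) ∈ I → monomial (expVec q) (1 : ℂ) ∈ I :=
    fun p q h => monomial_mem_of_le (expVec_mono h)
  have h10 : ∀ a b c, monomial (expVec (a, b + 1, c)) (1 : ℂ) ∈ I →
      monomial (expVec (a + 1, b, c)) (1 : ℂ) ∈ I := by
    intro a b c h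
    have := hBorel _ h 0 1 (by decide) (by simp)
    convert this using 3
    ext i; fin_cases i <;> simp
  have h21 : ∀ a b c, monomial (expVec (a, b, c + 1)) (1 : ℂ) ∈ I →
      monomial (expVec (a, b + 1, c)) (1 : ℂ) ∈ I := by
    intro a b c h
    have := hBorel _ h 1 2 (by decide) (by simp)
    convert this using 3
    ext i; fin_cases i <;> simp
  have hcard : {p | ¬ monomial (expVec p) (1 : ℂ) ∈ I}.ncard = 10 := by
    rw [← hcolen, ← Set.ncard_preimage_of_injective_subset_range expVec_bijective.injective
      (by simp [expVec_bijective.surjective.range_eq])]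
    rfl
  have hsq_of : ∀ p : ℕ × ℕ × ℕ, p.1 + p.2.1 + p.2.2 = 2 → monomial (expVec p) (1 : ℂ) ∈ I →
      monomial (expVec (2, 0, 0)) (1 : ℂ) ∈ I := by
    rintro ⟨a, b, c⟩ hd hp
    have hb : ∀ c a b, a + b + c = 2 → monomial (expVec (a, b, c)) (1 : ℂ) ∈ I →
        monomial (expVec (a, b + c, 0)) (1 : ℂ) ∈ I := by
      intro c
      induction c with
      | zero => exact fun a b _ h => h
      | succ c ih =>
        intro a b hd h
        have := ih a (b + 1) (by omega) (h21 _ _ _ h)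
        rwa [add_right_comm, add_assoc] at this
    have ha : ∀ b a, a + b = 2 → monomial (expVec (a, b, 0)) (1 : ℂ) ∈ I →
        monomial (expVec (2, 0, 0)) (1 : ℂ) ∈ I := by
      intro b
      induction b with
      | zero => rintro a rfl h; exact h
      | succ b ih => exact fun a hd h => ih (a + 1) (by omega) (h10 _ _ _ h)
    exact ha (b + c) a (by simp only at hd; omega) (hb c a b hd hp)
  obtain ⟨e, he⟩ := Set.ncard_eq_one.1 hdeg2
  have huniq : ∀ p : ℕ × ℕ × ℕ, p.1 + p.2.1 + p.2.2 = 2 → monomial (expVec p) (1 : ℂ) ∈ I →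
      expVec p = e :=
    fun p hd hp => Set.mem_singleton_iff.1 (he ▸ ⟨(expVec_degree p).trans hd, hp⟩)
  have hsq : monomial (expVec (2, 0, 0)) (1 : ℂ) ∈ I := by
    obtain ⟨p, rfl⟩ := expVec_bijective.surjective e
    have hmem : expVec p ∈ {e : Fin 3 →₀ ℕ | (e.sum fun _ n => n) = 2 ∧
      monomial e (1 : ℂ) ∈ I} := he ▸ Set.mem_singleton _
    exact hsq_of p ((expVec_degree p).symm.trans hmem.1) hmem.2
  have hlow : ∀ p ∈ smallExponents, ¬ monomial (expVec p) (1 : ℂ) ∈ I := by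
    intro p hp hpI
    have hp' : p ≤ (1, 0, 0) ∨ p.1 + p.2.1 + p.2.2 = 1 ∨
        (p.1 + p.2.1 + p.2.2 = 2 ∧ p ≠ (2, 0, 0)) := by
      clear hpI
      revert p; decide
    rcases hp' with h | h | ⟨h, hne⟩
    · exact hdeg1 _ (expVec_degree (1, 0, 0)) (hup _ _ h hpI)
    · exact hdeg1 _ ((expVec_degree p).trans h) hpI
    · exact hne (expVec_bijective.injective
        ((huniq p h hpI).trans (huniq (2, 0, 0) rfl hsq).symm))
  have key := not_mem_iff_of_borel (fun p => monomial (expVec p) (1 : ℂ) ∈ I)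
    hup h10 h21 hcard hsq hlow
  rw [span_generators_eq]
  apply le_antisymm
  · conv_lhs => rw [hI]
    rw [Ideal.span_le]
    rintro _ ⟨g, hg, rfl⟩
    obtain ⟨p, rfl⟩ := expVec_bijective.surjective g
    have hpI : monomial (expVec p) (1 : ℂ) ∈ I := by
      rw [hI]; exact Ideal.subset_span ⟨_, hg, rfl⟩
    obtain ⟨q, hq, hqp⟩ := exists_generatorExponents_le fun h => (key p).2 h hpI
    exact monomial_mem_of_le (expVec_mono hqp) (Ideal.subset_span ⟨q, hq, rfl⟩)
  · rw [Ideal.span_le]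
    rintro _ ⟨q, hq, rfl⟩
    by_contra hqI
    have hmem := (key q).1 hqI
    have hdisj : ∀ q ∈ generatorExponents, q ∉ insert (0, 0, 3) smallExponents := by decide
    exact hdisj q hq hmem
end

section
/- Let I ⊆ ℂ[x₀,x₁,x₂] be a Borel-fixed monomial ideal of colength 10 that contains no monomial of degree 1, contains exactly three monomials of degree 2, and is generated by the monomials of degree at most 4 that it contains. Then either I = (x₀², x₀x₁, x₀x₂, x₁³, x₁²x₂², x₁x₂³, x₂⁴) or I = (x₀², x₀x₁, x₁², x₀x₂³, x₁x₂³, x₂⁴). -/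
open MvPolynomial

/-- The exponent vector of `x₀ ^ a * x₁ ^ b * x₂ ^ c`. -/
noncomputable def exponent (a b c : ℕ) : Fin 3 →₀ ℕ :=
  Finsupp.equivFunOnFinite.symm ![a, b, c]

@[simp] lemma exponent_zero (a b c : ℕ) : exponent a b c 0 = a := rfl

@[simp] lemma exponent_one (a b c : ℕ) : exponent a b c 1 = b := rfl

@[simp] lemma exponent_two (a b c : ℕ) : exponent a b c 2 = c := rfl

lemma exponent_apply (e : Fin 3 →₀ ℕ) : exponent (e 0) (e 1) (e 2) = e := by
  ext i
  fin_cases i <;> rfl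

lemma exponent_degree (e : Fin 3 →₀ ℕ) : (e.sum fun _ n => n) = e 0 + e 1 + e 2 := by
  rw [Finsupp.sum_fintype _ _ (fun _ => rfl), Fin.sum_univ_three]

lemma monomial_exponent (a b c : ℕ) :
    monomial (exponent a b c) (1 : ℂ) = X 0 ^ a * X 1 ^ b * X 2 ^ c := by
  rw [monomial_eq, Finsupp.prod_fintype _ _ (fun _ => pow_zero _), Fin.prod_univ_three]
  simp

/-- The monomial `x₀ ^ a * x₁ ^ b * x₂ ^ c` belongs to `I`. -/
def MonomialMem (I : Ideal (MvPolynomial (Fin 3) ℂ)) (a b c : ℕ) : Prop :=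
  monomial (exponent a b c) (1 : ℂ) ∈ I

lemma MonomialMem.mono {I : Ideal (MvPolynomial (Fin 3) ℂ)} {a b c a' b' c' : ℕ}
    (h : MonomialMem I a b c) (ha : a ≤ a') (hb : b ≤ b') (hc : c ≤ c') :
    MonomialMem I a' b' c' := by
  unfold MonomialMem at *
  rw [monomial_exponent] at *
  exact I.mem_of_dvd
    (mul_dvd_mul (mul_dvd_mul (pow_dvd_pow _ ha) (pow_dvd_pow _ hb)) (pow_dvd_pow _ hc)) h

/-- The exponent vectors as a type of triples. -/
noncomputable def exponentEquiv : ℕ × ℕ × ℕ ≃ (Fin 3 →₀ ℕ) where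
  toFun p := exponent p.1 p.2.1 p.2.2
  invFun e := (e 0, e 1, e 2)
  left_inv _ := rfl
  right_inv e := exponent_apply e

lemma ncard_exponents (P : (Fin 3 →₀ ℕ) → Prop) (T : Finset (ℕ × ℕ × ℕ))
    (hT : ∀ a b c, P (exponent a b c) → (a, b, c) ∈ T) [DecidablePred fun p => P (exponentEquiv p)] :
    {e | P e}.ncard = ∑ p ∈ T, if P (exponentEquiv p) then 1 else 0 := by
  rw [← Finset.card_filter, ← Set.ncard_coe_finset, ← Set.ncard_image_of_injective _
    exponentEquiv.injective]
  congr 1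
  ext e
  simp only [Set.mem_ofPred_eq, Finset.coe_filter, Set.mem_image]
  constructor
  · intro h
    have h' : P (exponent (e 0) (e 1) (e 2)) := by rwa [exponent_apply]
    exact ⟨(e 0, e 1, e 2), ⟨hT _ _ _ h', h'⟩, exponent_apply e⟩
  · rintro ⟨p, ⟨-, hp⟩, rfl⟩
    exact hp

/-- A Borel-fixed ideal containing `x₂ ^ n` contains every monomial of degree at least `n`. -/
lemma MonomialMem.of_pow_last {I : Ideal (MvPolynomial (Fin 3) ℂ)} {n : ℕ}
    (h02 : ∀ a b c, MonomialMem I a b (c + 1) → MonomialMem I (a + 1) b c)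
    (h12 : ∀ a b c, MonomialMem I a b (c + 1) → MonomialMem I a (b + 1) c)
    (hn : MonomialMem I 0 0 n) {a b c : ℕ} (h : n ≤ a + b + c) : MonomialMem I a b c := by
  have hb : ∀ b c, MonomialMem I 0 0 (c + b) → MonomialMem I 0 b c := by
    intro b
    induction b with
    | zero => exact fun c hc => hc
    | succ b ih => exact fun c hc => h12 _ _ _ (ih (c + 1) (by rwa [add_right_comm]))
  have ha : ∀ a c, MonomialMem I 0 b (c + a) → MonomialMem I a b c := by
    intro a
    induction a with
    | zero => exact fun c hc => hc
    | succ a ih => exact fun c hc => h02 _ _ _ (ih (c + 1) (by rwa [add_right_comm]))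
  exact ha a c (hb b _ (hn.mono le_rfl le_rfl (by omega)))

/-- If some power of the last variable lies in an ideal generated by monomials of degree at most
`d`, then so does its `d`-th power. -/
lemma MonomialMem.pow_last_of_generated {I : Ideal (MvPolynomial (Fin 3) ℂ)} {d n : ℕ}
    (hgen : I = Ideal.span ((fun e => monomial e (1 : ℂ)) ''
        {e : Fin 3 →₀ ℕ | (e.sum fun _ n => n) ≤ d ∧ monomial e (1 : ℂ) ∈ I}))
    (hn : MonomialMem I 0 0 n) : MonomialMem I 0 0 d := by
  unfold MonomialMem at hn
  rw [hgen, mem_ideal_span_monomial_image] at hn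
  obtain ⟨e, ⟨hd, he⟩, hle⟩ := hn (exponent 0 0 n) (by simp)
  rw [exponent_degree] at hd
  have h0 : e 0 ≤ 0 := hle 0
  have h1 : e 1 ≤ 0 := hle 1
  have he' : MonomialMem I (e 0) (e 1) (e 2) := by rwa [MonomialMem, exponent_apply]
  exact he'.mono h0 h1 (by omega)

lemma eq_span_of_monomialMem {I : Ideal (MvPolynomial (Fin 3) ℂ)} {d : ℕ}
    {S : Set (MvPolynomial (Fin 3) ℂ)}
    (hgen : I = Ideal.span ((fun e => monomial e (1 : ℂ)) ''
        {e : Fin 3 →₀ ℕ | (e.sum fun _ n => n) ≤ d ∧ monomial e (1 : ℂ) ∈ I}))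
    (hS : ∀ s ∈ S, s ∈ I)
    (h : ∀ a b c, a + b + c ≤ d → MonomialMem I a b c → MonomialMem (Ideal.span S) a b c) :
    I = Ideal.span S := by
  refine le_antisymm ?_ (Ideal.span_le.2 hS)
  rw [hgen, Ideal.span_le]
  rintro _ ⟨e, ⟨hd, he⟩, rfl⟩
  rw [exponent_degree] at hd
  have := h (e 0) (e 1) (e 2) hd (by rwa [MonomialMem, exponent_apply])
  rwa [MonomialMem, exponent_apply] at this

/-- **Statement 4.** Let `I ⊆ ℂ[x₀,x₁,x₂]` be a Borel-fixed monomial ideal of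
colength 10 containing no monomial of degree 1, exactly three monomials of degree 2,
and generated by the monomials of degree at most 4 that it contains.  Then either
`I = (x₀², x₀x₁, x₀x₂, x₁³, x₁²x₂², x₁x₂³, x₂⁴)` or `I = (x₀², x₀x₁, x₁², x₀x₂³, x₁x₂³, x₂⁴)`. -/
theorem stmt_6 (I : Ideal (MvPolynomial (Fin 3) ℂ))
    (G : Set (Fin 3 →₀ ℕ))
    (hI : I = Ideal.span ((fun e => monomial e (1 : ℂ)) '' G))
    (hBorel : ∀ e : Fin 3 →₀ ℕ, monomial e (1 : ℂ) ∈ I →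
      ∀ i j : Fin 3, i < j → e j ≠ 0 →
        monomial (e - Finsupp.single j 1 + Finsupp.single i 1) (1 : ℂ) ∈ I)
    (hcolen : {e : Fin 3 →₀ ℕ | monomial e (1 : ℂ) ∉ I}.ncard = 10)
    (hdeg1 : ∀ e : Fin 3 →₀ ℕ, (e.sum fun _ n => n) = 1 → monomial e (1 : ℂ) ∉ I)
    (hdeg2 : {e : Fin 3 →₀ ℕ | (e.sum fun _ n => n) = 2 ∧ monomial e (1 : ℂ) ∈ I}.ncard = 3)
    (hgen4 : I = Ideal.span
      ((fun e => monomial e (1 : ℂ)) ''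
        {e : Fin 3 →₀ ℕ | (e.sum fun _ n => n) ≤ 4 ∧ monomial e (1 : ℂ) ∈ I})) :
    I = Ideal.span {X 0 ^ 2, X 0 * X 1, X 0 * X 2,
          X 1 ^ 3, X 1 ^ 2 * X 2 ^ 2, X 1 * X 2 ^ 3, X 2 ^ 4} ∨
      I = Ideal.span {X 0 ^ 2, X 0 * X 1, X 1 ^ 2,
          X 0 * X 2 ^ 3, X 1 * X 2 ^ 3, X 2 ^ 4} := by
  classical
  have h02 : ∀ a b c, MonomialMem I a b (c + 1) → MonomialMem I (a + 1) b c := by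
    intro a b c h
    have := hBorel _ h 0 2 (by decide) (by simp)
    rw [← exponent_apply (_ + _)] at this
    simpa [MonomialMem] using this
  have h12 : ∀ a b c, MonomialMem I a b (c + 1) → MonomialMem I a (b + 1) c := by
    intro a b c h
    have := hBorel _ h 1 2 (by decide) (by simp)
    rw [← exponent_apply (_ + _)] at this
    simpa [MonomialMem] using this
  have h01 : ∀ a b c, MonomialMem I a (b + 1) c → MonomialMem I (a + 1) b c := by
    intro a b c h
    have := hBorel _ h 0 1 (by decide) (by simp)
    rw [← exponent_apply (_ + _)] at this
    simpa [MonomialMem] using this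
  have hpow : ∃ n, MonomialMem I 0 0 n := by
    by_contra! hn
    have hfin := Set.finite_of_ncard_ne_zero (s := {e | monomial e (1 : ℂ) ∉ I}) (by omega)
    exact Set.infinite_of_injective_forall_mem (f := exponent 0 0)
      (fun m n h => by simpa using DFunLike.congr_fun h 2) hn hfin
  obtain ⟨n, hn⟩ := hpow
  have hfour : ∀ a b c, 4 ≤ a + b + c → MonomialMem I a b c := fun a b c h =>
    MonomialMem.of_pow_last h02 h12 (MonomialMem.pow_last_of_generated hgen4 hn) h
  have hlin : ∀ a b c, a + b + c = 1 → ¬ MonomialMem I a b c := fun a b c h =>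
    hdeg1 _ (by rw [exponent_degree]; exact h)
  have hone : ¬ MonomialMem I 0 0 0 := fun h =>
    hlin 1 0 0 rfl (h.mono (Nat.zero_le _) le_rfl le_rfl)
  rw [ncard_exponents _ ((Finset.range 4 ×ˢ Finset.range 4 ×ˢ Finset.range 4).filter
      fun p => p.1 + p.2.1 + p.2.2 < 4) (by
    intro a b c h
    have : a + b + c < 4 := by
      by_contra! h'
      exact h (hfour a b c h')
    simp only [Finset.mem_filter, Finset.mem_product, Finset.mem_range]
    omega)] at hcolen
  rw [ncard_exponents _ ((Finset.range 3 ×ˢ Finset.range 3 ×ˢ Finset.range 3).filter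
      fun p => p.1 + p.2.1 + p.2.2 = 2) (by
    rintro a b c ⟨h, -⟩
    rw [exponent_degree] at h
    simp only [exponent_zero, exponent_one, exponent_two] at h
    simp only [Finset.mem_filter, Finset.mem_product, Finset.mem_range]
    omega)] at hdeg2
  have hmem : ∀ p, monomial (exponentEquiv p) (1 : ℂ) ∈ I ↔ MonomialMem I p.1 p.2.1 p.2.2 :=
    fun _ => Iff.rfl
  have hdegree : ∀ p, ((exponentEquiv p).sum fun _ n => n) = p.1 + p.2.1 + p.2.2 :=
    fun p => exponent_degree _
  simp only [hmem, hdegree, Finset.sum_filter, Finset.sum_product, Finset.sum_range_succ,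
    Finset.sum_range_zero] at hcolen hdeg2
  simp [hone, hlin] at hcolen hdeg2
  have hdeg2' : MonomialMem I 2 0 0 ∧ MonomialMem I 1 1 0 ∧ ¬ MonomialMem I 0 1 1 ∧
      ¬ MonomialMem I 0 0 2 ∧ (MonomialMem I 1 0 1 ∧ ¬ MonomialMem I 0 2 0 ∨
        ¬ MonomialMem I 1 0 1 ∧ MonomialMem I 0 2 0) := by
    have := h02 0 0 1
    have := h01 0 0 1
    have := h12 0 0 1
    have := h12 0 1 0
    have := h02 0 1 0
    have := h01 0 1 0
    have := h01 1 0 0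
    have := h12 1 0 0
    grind
  clear hdeg2
  obtain ⟨h200, h110, h011, h002, ⟨h101, h020⟩ | ⟨h101, h020⟩⟩ := hdeg2'
  · have g300 : MonomialMem I 3 0 0 := h200.mono (by omega) (by omega) (by omega)
    have g210 : MonomialMem I 2 1 0 := h200.mono (by omega) (by omega) (by omega)
    have g201 : MonomialMem I 2 0 1 := h200.mono (by omega) (by omega) (by omega)
    have g120 : MonomialMem I 1 2 0 := h110.mono (by omega) (by omega) (by omega)
    have g111 : MonomialMem I 1 1 1 := h110.mono (by omega) (by omega) (by omega)
    have g102 : MonomialMem I 1 0 2 := h101.mono (by omega) (by omega) (by omega)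
    obtain ⟨h030, h021, h012, h003⟩ : MonomialMem I 0 3 0 ∧ ¬ MonomialMem I 0 2 1 ∧
        ¬ MonomialMem I 0 1 2 ∧ ¬ MonomialMem I 0 0 3 := by
      have := h12 0 0 2
      have := h12 0 1 1
      have := h12 0 2 0
      grind
    left
    refine eq_span_of_monomialMem hgen4 ?_ ?_
    · simp only [Set.mem_insert_iff, Set.mem_singleton_iff]
      rintro _ (rfl | rfl | rfl | rfl | rfl | rfl | rfl)
      · simpa [MonomialMem, monomial_exponent] using h200
      · simpa [MonomialMem, monomial_exponent] using h110
      · simpa [MonomialMem, monomial_exponent] using h101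
      · simpa [MonomialMem, monomial_exponent] using h030
      · simpa [MonomialMem, monomial_exponent] using (hfour _ _ _ le_rfl : MonomialMem I 0 2 2)
      · simpa [MonomialMem, monomial_exponent] using (hfour _ _ _ le_rfl : MonomialMem I 0 1 3)
      · simpa [MonomialMem, monomial_exponent] using (hfour _ _ _ le_rfl : MonomialMem I 0 0 4)
    · intro a b c hd h
      have hcases : (2 ≤ a) ∨ (1 ≤ a ∧ 1 ≤ b) ∨ (1 ≤ a ∧ 1 ≤ c) ∨ (3 ≤ b) ∨ (2 ≤ b ∧ 2 ≤ c) ∨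
          (1 ≤ b ∧ 3 ≤ c) ∨ (4 ≤ c) := by
        by_contra! hc
        have ha : a ≤ 1 := by omega
        have hb : b ≤ 2 := by omega
        have hc' : c ≤ 3 := by omega
        interval_cases a <;> interval_cases b <;> interval_cases c <;>
          first | omega | contradiction | exact hlin _ _ _ rfl h
      rcases hcases with hc | hc | hc | hc | hc | hc | hc
      · refine MonomialMem.mono (a := 2) (b := 0) (c := 0) (Ideal.subset_span ?_)
          (by omega) (by omega) (by omega)
        simp [monomial_exponent]
      · refine MonomialMem.mono (a := 1) (b := 1) (c := 0) (Ideal.subset_span ?_)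
          (by omega) (by omega) (by omega)
        simp [monomial_exponent]
      · refine MonomialMem.mono (a := 1) (b := 0) (c := 1) (Ideal.subset_span ?_)
          (by omega) (by omega) (by omega)
        simp [monomial_exponent]
      · refine MonomialMem.mono (a := 0) (b := 3) (c := 0) (Ideal.subset_span ?_)
          (by omega) (by omega) (by omega)
        simp [monomial_exponent]
      · refine MonomialMem.mono (a := 0) (b := 2) (c := 2) (Ideal.subset_span ?_)
          (by omega) (by omega) (by omega)
        simp [monomial_exponent]
      · refine MonomialMem.mono (a := 0) (b := 1) (c := 3) (Ideal.subset_span ?_)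
          (by omega) (by omega) (by omega)
        simp [monomial_exponent]
      · refine MonomialMem.mono (a := 0) (b := 0) (c := 4) (Ideal.subset_span ?_)
          (by omega) (by omega) (by omega)
        simp [monomial_exponent]
  · have g300 : MonomialMem I 3 0 0 := h200.mono (by omega) (by omega) (by omega)
    have g210 : MonomialMem I 2 1 0 := h200.mono (by omega) (by omega) (by omega)
    have g201 : MonomialMem I 2 0 1 := h200.mono (by omega) (by omega) (by omega)
    have g120 : MonomialMem I 1 2 0 := h110.mono (by omega) (by omega) (by omega)
    have g111 : MonomialMem I 1 1 1 := h110.mono (by omega) (by omega) (by omega)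
    have g030 : MonomialMem I 0 3 0 := h020.mono (by omega) (by omega) (by omega)
    have g021 : MonomialMem I 0 2 1 := h020.mono (by omega) (by omega) (by omega)
    obtain ⟨h102, h012, h003⟩ : ¬ MonomialMem I 1 0 2 ∧
        ¬ MonomialMem I 0 1 2 ∧ ¬ MonomialMem I 0 0 3 := by
      grind
    right
    refine eq_span_of_monomialMem hgen4 ?_ ?_
    · simp only [Set.mem_insert_iff, Set.mem_singleton_iff]
      rintro _ (rfl | rfl | rfl | rfl | rfl | rfl)
      · simpa [MonomialMem, monomial_exponent] using h200
      · simpa [MonomialMem, monomial_exponent] using h110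
      · simpa [MonomialMem, monomial_exponent] using h020
      · simpa [MonomialMem, monomial_exponent] using (hfour _ _ _ le_rfl : MonomialMem I 1 0 3)
      · simpa [MonomialMem, monomial_exponent] using (hfour _ _ _ le_rfl : MonomialMem I 0 1 3)
      · simpa [MonomialMem, monomial_exponent] using (hfour _ _ _ le_rfl : MonomialMem I 0 0 4)
    · intro a b c hd h
      have hcases : (2 ≤ a) ∨ (1 ≤ a ∧ 1 ≤ b) ∨ (2 ≤ b) ∨ (1 ≤ a ∧ 3 ≤ c) ∨
          (1 ≤ b ∧ 3 ≤ c) ∨ (4 ≤ c) := by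
        by_contra! hc
        have ha : a ≤ 1 := by omega
        have hb : b ≤ 2 := by omega
        have hc' : c ≤ 3 := by omega
        interval_cases a <;> interval_cases b <;> interval_cases c <;>
          first | omega | contradiction | exact hlin _ _ _ rfl h
      rcases hcases with hc | hc | hc | hc | hc | hc
      · refine MonomialMem.mono (a := 2) (b := 0) (c := 0) (Ideal.subset_span ?_)
          (by omega) (by omega) (by omega)
        simp [monomial_exponent]
      · refine MonomialMem.mono (a := 1) (b := 1) (c := 0) (Ideal.subset_span ?_)
          (by omega) (by omega) (by omega)
        simp [monomial_exponent]
      · refine MonomialMem.mono (a := 0) (b := 2) (c := 0) (Ideal.subset_span ?_)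
          (by omega) (by omega) (by omega)
        simp [monomial_exponent]
      · refine MonomialMem.mono (a := 1) (b := 0) (c := 3) (Ideal.subset_span ?_)
          (by omega) (by omega) (by omega)
        simp [monomial_exponent]
      · refine MonomialMem.mono (a := 0) (b := 1) (c := 3) (Ideal.subset_span ?_)
          (by omega) (by omega) (by omega)
        simp [monomial_exponent]
      · refine MonomialMem.mono (a := 0) (b := 0) (c := 4) (Ideal.subset_span ?_)
          (by omega) (by omega) (by omega)
        simp [monomial_exponent]
end

section
/- Work in ℂ[x₀,x₁,x₂,x₃,x₄] with the degree reverse lexicographic monomial order (x₀ > x₁ > x₂ > x₃ > x₄). Let J = (x₁x₄, x₀x₄, x₁x₃, x₀x₃) and let f be a nonzero homogeneous polynomial of degree 5 each of whose monomials involves only x₀, x₁, x₂ and whose coefficient of x₂⁵ is zero. Then in(J) ∩ in((f)) ⊆ in(J ∩ (f)), where in(·) denotes the initial ideal with respect to this order. -/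
open MvPolynomial

/-- Degree reverse lexicographic order on exponent vectors (with `x₀ > x₁ > ⋯ > x₄`):
`a < b` iff `a` has smaller total degree, or the degrees agree and at the largest
index where they differ, `a` has the larger exponent. -/
def RevLexLT (a b : Fin 5 →₀ ℕ) : Prop :=
  (a.sum fun _ n => n) < (b.sum fun _ n => n) ∨
    ((a.sum fun _ n => n) = (b.sum fun _ n => n) ∧
      ∃ i : Fin 5, b i < a i ∧ ∀ j : Fin 5, i < j → a j = b j)

/-- `d` is the exponent vector of the leading monomial of `h` for the degrevlex order. -/
def IsLeadExp (h : MvPolynomial (Fin 5) ℂ) (d : Fin 5 →₀ ℕ) : Prop :=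
  d ∈ h.support ∧ ∀ e ∈ h.support, e ≠ d → RevLexLT e d

/-- The initial ideal of `I` for the degrevlex order: the ideal generated by the
leading monomials of the nonzero elements of `I`. -/
noncomputable def initialIdeal (I : Ideal (MvPolynomial (Fin 5) ℂ)) :
    Ideal (MvPolynomial (Fin 5) ℂ) :=
  Ideal.span {p | ∃ h ∈ I, ∃ d : Fin 5 →₀ ℕ, IsLeadExp h d ∧ p = monomial d (1 : ℂ)}

theorem revLexLT_iff (a b : Fin 5 →₀ ℕ) :
    RevLexLT a b ↔ (a 0 + a 1 + a 2 + a 3 + a 4 < b 0 + b 1 + b 2 + b 3 + b 4 ∨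
      (a 0 + a 1 + a 2 + a 3 + a 4 = b 0 + b 1 + b 2 + b 3 + b 4 ∧
        (b 4 < a 4 ∨ a 4 = b 4 ∧ (b 3 < a 3 ∨ a 3 = b 3 ∧ (b 2 < a 2 ∨ a 2 = b 2 ∧
          (b 1 < a 1 ∨ a 1 = b 1 ∧ b 0 < a 0)))))) := by
  unfold RevLexLT
  rw [Finsupp.sum_fintype _ _ (by simp), Finsupp.sum_fintype _ _ (by simp)]
  simp only [Fin.sum_univ_five]
  refine or_congr_right (and_congr_right fun _ => ⟨?_, ?_⟩)
  · rintro ⟨i, hi, h⟩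
    have h0 := h 0
    have h1 := h 1
    have h2 := h 2
    have h3 := h 3
    have h4 := h 4
    fin_cases i <;> simp_all
  · rintro (h | ⟨h4, h | ⟨h3, h | ⟨h2, h | ⟨h1, h⟩⟩⟩⟩)
    · exact ⟨4, h, fun j hj => by fin_cases j <;> simp_all⟩
    · exact ⟨3, h, fun j hj => by fin_cases j <;> simp_all⟩
    · exact ⟨2, h, fun j hj => by fin_cases j <;> simp_all⟩
    · exact ⟨1, h, fun j hj => by fin_cases j <;> simp_all⟩
    · exact ⟨0, h, fun j hj => by fin_cases j <;> simp_all⟩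

theorem RevLexLT.irrefl (a : Fin 5 →₀ ℕ) : ¬ RevLexLT a a := by
  rw [revLexLT_iff]
  omega

theorem RevLexLT.trans {a b c : Fin 5 →₀ ℕ} (hab : RevLexLT a b) (hbc : RevLexLT b c) :
    RevLexLT a c := by
  rw [revLexLT_iff] at *
  omega

theorem RevLexLT.trichotomy (a b : Fin 5 →₀ ℕ) : RevLexLT a b ∨ a = b ∨ RevLexLT b a := by
  have h : a = b ↔ a 0 = b 0 ∧ a 1 = b 1 ∧ a 2 = b 2 ∧ a 3 = b 3 ∧ a 4 = b 4 := by
    rw [DFunLike.ext_iff]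
    simp [Fin.forall_fin_succ]
  rw [h, revLexLT_iff, revLexLT_iff]
  omega

theorem RevLexLT.add_right {a b : Fin 5 →₀ ℕ} (h : RevLexLT a b) (c : Fin 5 →₀ ℕ) :
    RevLexLT (a + c) (b + c) := by
  rw [revLexLT_iff] at *
  simp only [Finsupp.add_apply]
  omega

theorem RevLexLT.add_left {a b : Fin 5 →₀ ℕ} (h : RevLexLT a b) (c : Fin 5 →₀ ℕ) :
    RevLexLT (c + a) (c + b) := by
  simpa only [add_comm c] using h.add_right c

theorem RevLexLT.add_of_ne {a b p q : Fin 5 →₀ ℕ} (hp : p ≠ a → RevLexLT p a)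
    (hq : q ≠ b → RevLexLT q b) (h : p ≠ a ∨ q ≠ b) : RevLexLT (p + q) (a + b) := by
  by_cases hpa : p = a
  · subst hpa
    exact (hq (h.resolve_left (by simp))).add_left p
  by_cases hqb : q = b
  · subst hqb
    exact (hp hpa).add_right q
  exact ((hp hpa).add_right q).trans ((hq hqb).add_left a)

theorem IsLeadExp.unique {h : MvPolynomial (Fin 5) ℂ} {d e : Fin 5 →₀ ℕ}
    (hd : IsLeadExp h d) (he : IsLeadExp h e) : d = e := by
  by_contra hne
  exact RevLexLT.irrefl _ ((he.2 d hd.1 hne).trans (hd.2 e he.1 (Ne.symm hne)))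

theorem exists_isLeadExp {h : MvPolynomial (Fin 5) ℂ} (hh : h ≠ 0) : ∃ d, IsLeadExp h d := by
  have key : ∀ s : Finset (Fin 5 →₀ ℕ), s.Nonempty →
      ∃ d ∈ s, ∀ e ∈ s, e ≠ d → RevLexLT e d := by
    intro s hs
    induction hs using Finset.Nonempty.cons_induction with
    | singleton a => exact ⟨a, by simp, by simp⟩
    | cons a s ha hs ih =>
      obtain ⟨d, hd, hmax⟩ := ih
      rcases RevLexLT.trichotomy a d with had | rfl | hda
      · refine ⟨d, by simp [hd], fun e he hne => ?_⟩
        rcases Finset.mem_cons.1 he with rfl | he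
        · exact had
        · exact hmax e he hne
      · exact absurd hd ha
      · refine ⟨a, by simp, fun e he hne => ?_⟩
        have he := (Finset.mem_cons.1 he).resolve_left hne
        by_cases hed : e = d
        · exact hed ▸ hda
        · exact (hmax e he hed).trans hda
  exact key h.support (support_nonempty.2 hh)

theorem IsLeadExp.mul {g f : MvPolynomial (Fin 5) ℂ} {a b : Fin 5 →₀ ℕ}
    (hg : IsLeadExp g a) (hf : IsLeadExp f b) : IsLeadExp (g * f) (a + b) := by
  have hlt : ∀ p ∈ g.support, ∀ q ∈ f.support, p ≠ a ∨ q ≠ b → RevLexLT (p + q) (a + b) :=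
    fun p hp q hq h => RevLexLT.add_of_ne (hg.2 p hp) (hf.2 q hq) h
  refine ⟨?_, fun e he hne => ?_⟩
  · rw [mem_support_iff, coeff_mul, Finset.sum_eq_single (a, b)]
    · exact mul_ne_zero (mem_support_iff.1 hg.1) (mem_support_iff.1 hf.1)
    · rintro ⟨p, q⟩ hpq hne
      by_contra hmul
      have hp := mem_support_iff.2 (left_ne_zero_of_mul hmul)
      have hq := mem_support_iff.2 (right_ne_zero_of_mul hmul)
      have hpq' : p + q = a + b := by simpa using hpq
      refine RevLexLT.irrefl (a + b) ?_
      have := hlt p hp q hq (by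
        by_contra! hcon
        exact hne (Prod.ext hcon.1 hcon.2))
      rwa [hpq'] at this
    · simp
  · obtain ⟨p, hp, q, hq, rfl⟩ := Finset.mem_add.1 (support_mul g f he)
    refine hlt p hp q hq ?_
    by_contra! hcon
    exact hne (by rw [hcon.1, hcon.2])

theorem isLeadExp_monomial (d : Fin 5 →₀ ℕ) : IsLeadExp (monomial d (1 : ℂ)) d := by
  classical
  simp [IsLeadExp, support_monomial]

/-- Every exponent of an element of `initialIdeal I` dominates a leading exponent of an
element of `I`. -/
theorem exists_isLeadExp_le_of_mem_initialIdeal {I : Ideal (MvPolynomial (Fin 5) ℂ)}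
    {p : MvPolynomial (Fin 5) ℂ} (hp : p ∈ initialIdeal I) {e : Fin 5 →₀ ℕ}
    (he : e ∈ p.support) : ∃ h ∈ I, ∃ d, IsLeadExp h d ∧ d ≤ e := by
  have hset : {p | ∃ h ∈ I, ∃ d : Fin 5 →₀ ℕ, IsLeadExp h d ∧ p = monomial d (1 : ℂ)} =
      (fun d => monomial d (1 : ℂ)) '' {d | ∃ h ∈ I, IsLeadExp h d} := by
    ext q
    constructor
    · rintro ⟨h, hI, d, hd, rfl⟩
      exact ⟨d, ⟨h, hI, hd⟩, rfl⟩
    · rintro ⟨d, ⟨h, hI, hd⟩, rfl⟩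
      exact ⟨h, hI, d, hd, rfl⟩
  rw [initialIdeal, hset, mem_ideal_span_monomial_image] at hp
  obtain ⟨d, ⟨h, hI, hd⟩, hle⟩ := hp e he
  exact ⟨h, hI, d, hd, hle⟩

theorem mem_span_X_pair_iff {i j : Fin 5} {p : MvPolynomial (Fin 5) ℂ} :
    p ∈ Ideal.span {(X i : MvPolynomial (Fin 5) ℂ), X j} ↔
      ∀ e ∈ p.support, e i ≠ 0 ∨ e j ≠ 0 := by
  rw [← Set.image_pair, mem_ideal_span_X_image]
  simp

theorem span_pair_mul_span_pair_le :
    Ideal.span {(X 3 : MvPolynomial (Fin 5) ℂ), X 4} * Ideal.span {X 0, X 1} ≤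
      Ideal.span {X 1 * X 4, X 0 * X 4, X 1 * X 3, X 0 * X 3} := by
  rw [Ideal.span_mul_span', Ideal.span_le]
  rintro _ ⟨a, ha, b, hb, rfl⟩
  refine Ideal.subset_span ?_
  rcases ha with rfl | rfl <;> rcases hb with rfl | rfl <;>
    simp [mul_comm]

theorem span_le_span_X_three_four :
    Ideal.span {(X 1 * X 4 : MvPolynomial (Fin 5) ℂ), X 0 * X 4, X 1 * X 3, X 0 * X 3} ≤
      Ideal.span {X 3, X 4} := by
  rw [Ideal.span_le]
  rintro _ (rfl | rfl | rfl | rfl) <;>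
    exact Ideal.mul_mem_left _ _ (Ideal.subset_span (by simp))

/-- Let `J = (x₁x₄, x₀x₄, x₁x₃, x₀x₃)` and let `f` be a nonzero
homogeneous quintic in `x₀,x₁,x₂` only with zero coefficient of `x₂⁵`.  Then
`in(J) ∩ in((f)) ⊆ in(J ∩ (f))` for the degrevlex order. -/
theorem stmt_15 (f : MvPolynomial (Fin 5) ℂ) (hf0 : f ≠ 0)
    (hf5 : f.IsHomogeneous 5)
    (hfvars : ∀ e ∈ f.support, e 3 = 0 ∧ e 4 = 0)
    (hfx2 : coeff (Finsupp.single 2 5) f = 0)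
    (J : Ideal (MvPolynomial (Fin 5) ℂ))
    (hJ : J = Ideal.span {X 1 * X 4, X 0 * X 4, X 1 * X 3, X 0 * X 3}) :
    initialIdeal J ⊓ initialIdeal (Ideal.span {f})
      ≤ initialIdeal (J ⊓ Ideal.span {f}) := by
  subst hJ
  obtain ⟨m, hm⟩ := exists_isLeadExp hf0
  have hf01 : f ∈ Ideal.span {(X 0 : MvPolynomial (Fin 5) ℂ), X 1} := by
    rw [mem_span_X_pair_iff]
    intro e he
    by_contra! h01
    obtain ⟨h3, h4⟩ := hfvars e he
    have hdeg : e.degree = 5 := by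
      rw [Finsupp.degree_eq_weight_one]
      exact hf5 (mem_support_iff.1 he)
    rw [Finsupp.degree_eq_sum, Fin.sum_univ_five] at hdeg
    have heq : e = Finsupp.single 2 5 := by
      ext i
      fin_cases i <;> simp <;> omega
    exact mem_support_iff.1 he (heq ▸ hfx2)
  intro p hp
  rw [← p.support_sum_monomial_coeff]
  refine Ideal.sum_mem _ fun e he => ?_
  obtain ⟨h, hhJ, d, hd, hde⟩ := exists_isLeadExp_le_of_mem_initialIdeal hp.1 he
  obtain ⟨k, hkf, c, hc, hce⟩ := exists_isLeadExp_le_of_mem_initialIdeal hp.2 he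
  have hme : m ≤ e := by
    obtain ⟨g, rfl⟩ := Ideal.mem_span_singleton'.1 hkf
    have hg0 : g ≠ 0 := by
      rintro rfl
      simpa using hc.1
    obtain ⟨a, ha⟩ := exists_isLeadExp hg0
    rw [hc.unique (ha.mul hm)] at hce
    exact le_add_self.trans hce
  obtain ⟨v, rfl⟩ : ∃ v, e = v + m := ⟨e - m, (tsub_add_cancel_of_le hme).symm⟩
  have hd34 := mem_span_X_pair_iff.1 (span_le_span_X_three_four hhJ) d hd.1
  have hv : monomial v (1 : ℂ) ∈ Ideal.span {(X 3 : MvPolynomial (Fin 5) ℂ), X 4} := by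
    rw [mem_span_X_pair_iff]
    intro w hw
    obtain rfl : w = v := by
      classical
      simpa [support_monomial] using hw
    obtain ⟨h3, h4⟩ := hfvars m hm.1
    have hd3 := hde 3
    have hd4 := hde 4
    rw [Finsupp.add_apply] at hd3 hd4
    omega
  have hlead : monomial (v + m) (1 : ℂ) ∈ initialIdeal
      (Ideal.span {X 1 * X 4, X 0 * X 4, X 1 * X 3, X 0 * X 3} ⊓ Ideal.span {f}) :=
    Ideal.subset_span ⟨monomial v 1 * f,
      ⟨span_pair_mul_span_pair_le (Ideal.mul_mem_mul hv hf01),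
        Ideal.mul_mem_left _ _ (Ideal.mem_span_singleton_self f)⟩,
      v + m, (isLeadExp_monomial v).mul hm, rfl⟩
  simpa [C_mul_monomial] using Ideal.mul_mem_left _ (C (coeff (v + m) p)) hlead
end
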